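/- (Interior error-kernel estimate) Let m, d be integers with m > d/2, let φ = φ_{m,d} be the surface spline fundamental solution, and fix constants K ≥ 1, Γ > 0 and h > 0. Let Ξ ⊂ ℝ^d be a finite set, let A ⊆ ℝ^d, and let a : ℝ^d × Ξ → ℝ be a stable, local polynomial reproduction of order 2m on A, i.e., for every α ∈ A: (i) Σ_{ξ∈Ξ} |a(α,ξ)| ≤ K; (ii) Σ_{ξ∈Ξ} a(α,ξ) p(ξ) = p(α) for every polynomial p in d variables of total degree at most 2m; (iii) a(α,ξ) = 0 whenever ‖α − ξ‖ > Γ·h. Then there exists a constant C depending only on d, m, K and Γ (not on h, Ξ, A or a) such that for all x ∈ ℝ^d and all α ∈ A, |φ(x − α) − Σ_{ξ∈Ξ} a(α,ξ) φ(x − ξ)| ≤ C · h^{2m−d} · (1 + ‖x − α‖/h)^{−(d+1)}. -/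

import Mathlib

open MeasureTheory

/-- The surface spline `φ_{m,d}`, the fundamental solution (up to a constant, here
normalized to 1) of the `m`-fold Laplacian on `ℝ^d`:
`‖x‖^{2m-d} log‖x‖` for even `d`, and `‖x‖^{2m-d}` for odd `d` (vanishing at `0`). -/
noncomputable def surfSpline (m d : ℕ) (x : EuclideanSpace ℝ (Fin d)) : ℝ :=
  if Even d then ‖x‖ ^ (2 * (m : ℝ) - d) * Real.log ‖x‖ else ‖x‖ ^ (2 * (m : ℝ) - d)

/-- `F` is a real polynomial function on `ℝ^d` of total degree at most `N`. -/
def IsPolyFun {d : ℕ} (N : ℕ) (F : EuclideanSpace ℝ (Fin d) → ℝ) : Prop :=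
  ∃ p : MvPolynomial (Fin d) ℝ, p.totalDegree ≤ N ∧
    ∀ y, F y = MvPolynomial.eval (fun i => y i) p

namespace IsPolyFun

variable {d N M : ℕ} {F G : EuclideanSpace ℝ (Fin d) → ℝ}

lemma mono (hF : IsPolyFun N F) (h : N ≤ M) : IsPolyFun M F := by
  obtain ⟨p, hp, hpF⟩ := hF
  exact ⟨p, hp.trans h, hpF⟩

lemma const (c : ℝ) : IsPolyFun N (fun _ : EuclideanSpace ℝ (Fin d) => c) :=
  ⟨MvPolynomial.C c, by simp, by simp⟩

lemma coord (i : Fin d) : IsPolyFun 1 (fun y : EuclideanSpace ℝ (Fin d) => y i) :=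
  ⟨MvPolynomial.X i, by simp, by simp⟩

lemma add (hF : IsPolyFun N F) (hG : IsPolyFun N G) : IsPolyFun N (fun y => F y + G y) := by
  obtain ⟨p, hp, hpF⟩ := hF
  obtain ⟨q, hq, hqG⟩ := hG
  exact ⟨p + q, (MvPolynomial.totalDegree_add p q).trans (max_le hp hq), by simp [hpF, hqG]⟩

lemma mul (hF : IsPolyFun N F) (hG : IsPolyFun M G) :
    IsPolyFun (N + M) (fun y => F y * G y) := by
  obtain ⟨p, hp, hpF⟩ := hF
  obtain ⟨q, hq, hqG⟩ := hG
  exact ⟨p * q, (MvPolynomial.totalDegree_mul p q).trans (add_le_add hp hq), by simp [hpF, hqG]⟩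

lemma const_mul (c : ℝ) (hF : IsPolyFun N F) : IsPolyFun N (fun y => c * F y) := by
  simpa using (const (N := 0) c).mul hF

lemma pow (hF : IsPolyFun N F) (n : ℕ) : IsPolyFun (n * N) (fun y => F y ^ n) := by
  obtain ⟨p, hp, hpF⟩ := hF
  exact ⟨p ^ n, (MvPolynomial.totalDegree_pow p n).trans (Nat.mul_le_mul_left n hp),
    by simp [hpF]⟩

lemma sum {ι : Type*} (s : Finset ι) {f : ι → EuclideanSpace ℝ (Fin d) → ℝ}
    (hf : ∀ i ∈ s, IsPolyFun N (f i)) : IsPolyFun N (fun y => ∑ i ∈ s, f i y) := by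
  classical
  induction s using Finset.induction_on with
  | empty => simpa using const 0
  | insert i s hi ih =>
    simp only [Finset.sum_insert hi]
    exact (hf i (Finset.mem_insert_self i s)).add
      (ih fun j hj => hf j (Finset.mem_insert_of_mem hj))

lemma prod {ι : Type*} (s : Finset ι) {f : ι → EuclideanSpace ℝ (Fin d) → ℝ} {n : ι → ℕ}
    (hf : ∀ i ∈ s, IsPolyFun (n i) (f i)) :
    IsPolyFun (∑ i ∈ s, n i) (fun y => ∏ i ∈ s, f i y) := by
  classical
  induction s using Finset.induction_on with
  | empty => simpa using const 1
  | insert i s hi ih =>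
    simp only [Finset.prod_insert hi, Finset.sum_insert hi]
    exact (hf i (Finset.mem_insert_self i s)).mul
      (ih fun j hj => hf j (Finset.mem_insert_of_mem hj))

lemma inner_right (v : EuclideanSpace ℝ (Fin d)) :
    IsPolyFun 1 (fun y : EuclideanSpace ℝ (Fin d) => inner ℝ v y) := by
  have h := sum Finset.univ fun i _ => (coord (d := d) i).const_mul (v i)
  simpa [PiLp.inner_apply, mul_comm] using h

lemma norm_sq : IsPolyFun 2 (fun y : EuclideanSpace ℝ (Fin d) => ‖y‖ ^ 2) := by
  have h := sum Finset.univ fun i _ => (coord (d := d) i).pow 2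
  simpa [EuclideanSpace.norm_sq_eq] using h

lemma comp_affine (hF : IsPolyFun N F) (c : ℝ) (α : EuclideanSpace ℝ (Fin d)) :
    IsPolyFun N (fun y => F (c • (y - α))) := by
  obtain ⟨p, hp, hpF⟩ := hF
  simp only [hpF, MvPolynomial.eval_eq']
  refine sum _ fun e he => const_mul _ ?_
  have hlin (i : Fin d) :
      IsPolyFun 1 (fun y : EuclideanSpace ℝ (Fin d) => (c • (y - α)) i) := by
    have h := ((coord i).add (const (-α i))).const_mul c
    simpa [sub_eq_add_neg, mul_add] using h
  refine (prod Finset.univ fun i _ => (hlin i).pow (e i)).mono ?_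
  have h := (MvPolynomial.le_totalDegree he).trans hp
  rw [Finsupp.sum_fintype _ _ fun _ => rfl] at h
  simpa using h

end IsPolyFun

/-- The functions `F v`, for `v` in the unit sphere, agree near the origin with polynomials of
degree at most `N`, up to an error of order `N + 1`, uniformly in `v`. -/
def UnifPolyApprox {d : ℕ} (N : ℕ)
    (F : EuclideanSpace ℝ (Fin d) → EuclideanSpace ℝ (Fin d) → ℝ) : Prop :=
  ∃ ε > 0, ∃ C ≥ 0, ∀ v, ‖v‖ = 1 → ∃ P, IsPolyFun N P ∧
    ∀ y, ‖y‖ ≤ ε → |F v y - P y| ≤ C * ‖y‖ ^ (N + 1)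

namespace UnifPolyApprox

variable {d N : ℕ} {F G : EuclideanSpace ℝ (Fin d) → EuclideanSpace ℝ (Fin d) → ℝ}

lemma of_isPolyFun (hF : ∀ v, IsPolyFun N (F v)) : UnifPolyApprox N F :=
  ⟨1, one_pos, 0, le_rfl, fun v _ => ⟨F v, hF v, by simp⟩⟩

lemma of_bound {ε C : ℝ} (hε : 0 < ε) (hC : 0 ≤ C)
    (hF : ∀ v, ‖v‖ = 1 → ∀ y, ‖y‖ ≤ ε → |F v y| ≤ C * ‖y‖ ^ (N + 1)) : UnifPolyApprox N F :=
  ⟨ε, hε, C, hC, fun v hv => ⟨fun _ => 0, IsPolyFun.const 0, by simpa using hF v hv⟩⟩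

lemma add (hF : UnifPolyApprox N F) (hG : UnifPolyApprox N G) :
    UnifPolyApprox N (fun v y => F v y + G v y) := by
  obtain ⟨ε, hε, C, hC, hF⟩ := hF
  obtain ⟨δ, hδ, D, hD, hG⟩ := hG
  refine ⟨min ε δ, lt_min hε hδ, C + D, by positivity, fun v hv => ?_⟩
  obtain ⟨P, hP, hFP⟩ := hF v hv
  obtain ⟨Q, hQ, hGQ⟩ := hG v hv
  refine ⟨_, hP.add hQ, fun y hy => ?_⟩
  have h₁ := hFP y (hy.trans (min_le_left _ _))
  have h₂ := hGQ y (hy.trans (min_le_right _ _))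
  calc |F v y + G v y - (P y + Q y)| = |(F v y - P y) + (G v y - Q y)| := by ring_nf
    _ ≤ |F v y - P y| + |G v y - Q y| := abs_add_le _ _
    _ ≤ (C + D) * ‖y‖ ^ (N + 1) := by linarith

lemma const_mul (c : ℝ) (hF : UnifPolyApprox N F) : UnifPolyApprox N (fun v y => c * F v y) := by
  obtain ⟨ε, hε, C, hC, hF⟩ := hF
  refine ⟨ε, hε, |c| * C, by positivity, fun v hv => ?_⟩
  obtain ⟨P, hP, hFP⟩ := hF v hv
  refine ⟨_, hP.const_mul c, fun y hy => ?_⟩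
  rw [← mul_sub, abs_mul, mul_assoc]
  exact mul_le_mul_of_nonneg_left (hFP y hy) (abs_nonneg c)

lemma sum {ι : Type*} (s : Finset ι)
    {f : ι → EuclideanSpace ℝ (Fin d) → EuclideanSpace ℝ (Fin d) → ℝ}
    (hf : ∀ i ∈ s, UnifPolyApprox N (f i)) :
    UnifPolyApprox N (fun v y => ∑ i ∈ s, f i v y) := by
  classical
  induction s using Finset.induction_on with
  | empty => simpa using of_isPolyFun fun _ => IsPolyFun.const 0
  | insert i s hi ih =>
    simp only [Finset.sum_insert hi]
    exact (hf i (Finset.mem_insert_self i s)).add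
      (ih fun j hj => hf j (Finset.mem_insert_of_mem hj))

lemma inner_pow_mul_norm_sq_pow (a b : ℕ) :
    UnifPolyApprox (d := d) N (fun v y => inner ℝ v y ^ a * (‖y‖ ^ 2) ^ b) := by
  rcases le_or_gt (a + 2 * b) N with h | h
  · refine of_isPolyFun fun v => (((IsPolyFun.inner_right v).pow a).mul
      (IsPolyFun.norm_sq.pow b)).mono (by omega)
  · refine of_bound one_pos zero_le_one fun v hv y hy => ?_
    have hin : |inner ℝ v y| ≤ ‖y‖ := by simpa [hv] using abs_real_inner_le_norm v y
    calc |inner ℝ v y ^ a * (‖y‖ ^ 2) ^ b| = |inner ℝ v y| ^ a * (‖y‖ ^ 2) ^ b := by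
          rw [abs_mul, abs_pow, abs_of_nonneg (by positivity : 0 ≤ (‖y‖ ^ 2) ^ b)]
      _ ≤ ‖y‖ ^ a * (‖y‖ ^ 2) ^ b := by gcongr
      _ = ‖y‖ ^ (a + 2 * b) := by rw [← pow_mul, ← pow_add]
      _ ≤ ‖y‖ ^ (N + 1) := pow_le_pow_of_le_one (norm_nonneg y) hy h
      _ = 1 * ‖y‖ ^ (N + 1) := (one_mul _).symm

lemma norm_sub_sq_sub_one_pow (k : ℕ) :
    UnifPolyApprox (d := d) N (fun v y => (-2 * inner ℝ v y + ‖y‖ ^ 2) ^ k) := by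
  simp only [add_pow]
  refine sum _ fun j _ => ?_
  convert (inner_pow_mul_norm_sq_pow (d := d) (N := N) j (k - j)).const_mul
    ((-2) ^ j * (k.choose j : ℝ)) using 3
  ring

/-- Substituting `‖v - y‖ ^ 2 - 1` into a function analytic at the origin. -/
lemma comp_analyticAt {g : ℝ → ℝ} (hg : AnalyticAt ℝ g 0) :
    UnifPolyApprox (d := d) N (fun v y => g (-2 * inner ℝ v y + ‖y‖ ^ 2)) := by
  obtain ⟨p, hp⟩ := hg
  obtain ⟨C, hC, hO⟩ := (hp.isBigO_sub_partialSum_pow (N + 1)).exists_pos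
  obtain ⟨δ, hδ, hball⟩ := Metric.eventually_nhds_iff.1 hO.bound
  have hsum : UnifPolyApprox (d := d) N
      (fun v y => p.partialSum (N + 1) (-2 * inner ℝ v y + ‖y‖ ^ 2)) := by
    simp only [FormalMultilinearSeries.partialSum,
      FormalMultilinearSeries.apply_eq_pow_smul_coeff, smul_eq_mul]
    refine sum _ fun k _ => ?_
    simpa only [mul_comm] using (norm_sub_sq_sub_one_pow k).const_mul (p.coeff k)
  have hrem : UnifPolyApprox (d := d) N (fun v y => g (-2 * inner ℝ v y + ‖y‖ ^ 2) -
      p.partialSum (N + 1) (-2 * inner ℝ v y + ‖y‖ ^ 2)) := by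
    refine of_bound (ε := min 1 (δ / 4)) (C := C * 3 ^ (N + 1)) (by positivity) (by positivity)
      fun v hv y hy => ?_
    have hin : |inner ℝ v y| ≤ ‖y‖ := by simpa [hv] using abs_real_inner_le_norm v y
    have hy₁ := hy.trans (min_le_left _ _)
    have hy₂ := hy.trans (min_le_right _ _)
    have ht : |-2 * inner ℝ v y + ‖y‖ ^ 2| ≤ 3 * ‖y‖ := by
      obtain ⟨h₁, h₂⟩ := abs_le.1 hin
      have := norm_nonneg y
      exact abs_le.2 ⟨by nlinarith, by nlinarith⟩
    have hb := hball (y := -2 * inner ℝ v y + ‖y‖ ^ 2)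
      (by rw [Real.dist_eq, sub_zero]; linarith)
    simp only [zero_add, Real.norm_eq_abs, abs_pow, abs_abs] at hb
    calc _ ≤ C * |-2 * inner ℝ v y + ‖y‖ ^ 2| ^ (N + 1) := hb
      _ ≤ C * (3 * ‖y‖) ^ (N + 1) := by gcongr
      _ = C * 3 ^ (N + 1) * ‖y‖ ^ (N + 1) := by rw [mul_pow, mul_assoc]
  simpa using hrem.add hsum

end UnifPolyApprox

section SurfSpline

variable {m d : ℕ}

lemma surfSpline_eq (hm : d < 2 * m) (z : EuclideanSpace ℝ (Fin d)) :
    surfSpline m d z =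
      ‖z‖ ^ (2 * m - d) * (if Even d then Real.log ‖z‖ else 1) := by
  have h : (2 * (m : ℝ) - d) = ((2 * m - d : ℕ) : ℝ) := by
    rw [Nat.cast_sub hm.le]; push_cast; rfl
  unfold surfSpline
  split_ifs <;> simp [h, Real.rpow_natCast]

lemma exists_surfSpline_bound (hm : d < 2 * m) (S : ℝ) :
    ∃ B ≥ 0, ∀ z : EuclideanSpace ℝ (Fin d), ‖z‖ ≤ S → |surfSpline m d z| ≤ B := by
  obtain ⟨e, he⟩ : ∃ e, 2 * m - d = e + 1 := ⟨2 * m - d - 1, by omega⟩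
  have hcont : Continuous fun s : ℝ => s ^ e * (if Even d then s * Real.log s else s) := by
    split_ifs
    · exact (continuous_pow e).mul Real.continuous_mul_log
    · fun_prop
  obtain ⟨B, hB⟩ := (isCompact_Icc (a := (0 : ℝ)) (b := S)).exists_bound_of_continuousOn
    hcont.continuousOn
  refine ⟨max B 0, le_max_right _ _, fun z hz => le_max_of_le_left ?_⟩
  refine le_of_eq_of_le ?_ (hB ‖z‖ ⟨norm_nonneg z, hz⟩)
  rw [surfSpline_eq hm, he, Real.norm_eq_abs]
  split_ifs <;> ring_nf

/-- The surface spline is homogeneous up to polynomials of degree at most `2m`. -/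
lemma exists_surfSpline_scaling (hm : d < 2 * m) {c : ℝ} (hc : 0 < c)
    (x : EuclideanSpace ℝ (Fin d)) :
    ∃ Q : EuclideanSpace ℝ (Fin d) → ℝ, IsPolyFun (2 * m) Q ∧
      ∀ ξ, surfSpline m d (x - ξ) =
        c ^ (2 * m - d) * surfSpline m d (c⁻¹ • (x - ξ)) + Q ξ := by
  have hscale (ξ : EuclideanSpace ℝ (Fin d)) : ‖x - ξ‖ = c * ‖c⁻¹ • (x - ξ)‖ := by
    rw [norm_smul, norm_inv, Real.norm_of_nonneg hc.le, mul_inv_cancel_left₀ hc.ne']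
  by_cases hd : Even d
  · refine ⟨fun ξ => Real.log c * ‖x - ξ‖ ^ (2 * m - d), ?_, fun ξ => ?_⟩
    · obtain ⟨k, hk⟩ := hd
      have h := (((IsPolyFun.norm_sq.comp_affine 1 x).pow (m - k)).const_mul
        (Real.log c)).mono (M := 2 * m) (by omega)
      have he : 2 * m - d = 2 * (m - k) := by omega
      simpa [he, pow_mul, norm_sub_rev x] using h
    · simp only [surfSpline_eq hm, hd, if_true]
      rw [hscale ξ]
      rcases eq_or_ne ‖c⁻¹ • (x - ξ)‖ 0 with h | h
      · have : 2 * m - d ≠ 0 := by omega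
        simp [h, this]
      · rw [Real.log_mul hc.ne' h, mul_pow]
        ring
  · refine ⟨fun _ => 0, IsPolyFun.const 0, fun ξ => ?_⟩
    simp only [surfSpline_eq hm, hd, if_false]
    rw [hscale ξ, mul_pow]
    ring

lemma unifPolyApprox_surfSpline (hm : d < 2 * m) (N : ℕ) :
    UnifPolyApprox N (fun v y => surfSpline m d (v - y)) := by
  have hpow : AnalyticAt ℝ (fun t : ℝ => (1 + t) ^ (((2 * m - d : ℕ) : ℝ) / 2)) 0 :=
    Real.one_add_rpow_hasFPowerSeriesAt_zero.analyticAt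
  have hlog : AnalyticAt ℝ (fun t : ℝ => if Even d then 2⁻¹ * Real.log (1 + t) else 1) 0 := by
    split_ifs
    · exact analyticAt_const.mul ((analyticAt_const.add analyticAt_id).log (by simp))
    · exact analyticAt_const
  obtain ⟨ε, hε, C, hC, happrox⟩ :=
    UnifPolyApprox.comp_analyticAt (d := d) (N := N) (hpow.mul hlog)
  refine ⟨ε, hε, C, hC, fun v hv => ?_⟩
  obtain ⟨P, hP, hPy⟩ := happrox v hv
  refine ⟨P, hP, fun y hy => ?_⟩
  refine le_of_eq_of_le ?_ (hPy y hy)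
  have hnorm : 1 + (-2 * inner ℝ v y + ‖y‖ ^ 2) = ‖v - y‖ ^ 2 := by
    rw [norm_sub_sq_real, hv]; ring
  simp only [surfSpline_eq hm, Pi.mul_apply, hnorm]
  congr 3
  · rw [← Real.rpow_natCast ‖v - y‖ 2, ← Real.rpow_mul (norm_nonneg _)]
    simp [mul_div_cancel₀]
  · simp [Real.log_pow]

end SurfSpline

/-- Error of a stable local polynomial reproduction in terms of local polynomial approximation. -/
lemma abs_sub_sum_le_of_isPolyFun {d N : ℕ} {K ρ B : ℝ} (hρ : 0 ≤ ρ) (hB : 0 ≤ B)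
    {Ξ : Finset (EuclideanSpace ℝ (Fin d))} {α : EuclideanSpace ℝ (Fin d)}
    {w : EuclideanSpace ℝ (Fin d) → ℝ} (hw : ∑ ξ ∈ Ξ, |w ξ| ≤ K)
    (hrep : ∀ p : MvPolynomial (Fin d) ℝ, p.totalDegree ≤ N →
      ∑ ξ ∈ Ξ, w ξ * MvPolynomial.eval (fun i => ξ i) p = MvPolynomial.eval (fun i => α i) p)
    (hloc : ∀ ξ ∈ Ξ, ρ < ‖α - ξ‖ → w ξ = 0)
    {F P : EuclideanSpace ℝ (Fin d) → ℝ} (hP : IsPolyFun N P)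
    (hFP : ∀ ξ, ‖ξ - α‖ ≤ ρ → |F ξ - P ξ| ≤ B) :
    |F α - ∑ ξ ∈ Ξ, w ξ * F ξ| ≤ (1 + K) * B := by
  obtain ⟨p, hp, hpP⟩ := hP
  have hPα : ∑ ξ ∈ Ξ, w ξ * P ξ = P α := by simpa only [hpP] using hrep p hp
  have hsum : |∑ ξ ∈ Ξ, w ξ * (F ξ - P ξ)| ≤ K * B := by
    refine (Finset.abs_sum_le_sum_abs _ _).trans ?_
    refine le_trans ?_ (mul_le_mul_of_nonneg_right hw hB)
    rw [Finset.sum_mul]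
    refine Finset.sum_le_sum fun ξ hξ => ?_
    rw [abs_mul]
    rcases le_or_gt ‖α - ξ‖ ρ with h | h
    · exact mul_le_mul_of_nonneg_left (hFP ξ (by rwa [norm_sub_rev])) (abs_nonneg _)
    · simp [hloc ξ hξ h]
  have hα := hFP α (by simpa using hρ)
  calc |F α - ∑ ξ ∈ Ξ, w ξ * F ξ|
      = |(F α - P α) - ∑ ξ ∈ Ξ, w ξ * (F ξ - P ξ)| := by
        simp only [mul_sub, Finset.sum_sub_distrib, hPα]; ring_nf
    _ ≤ |F α - P α| + |∑ ξ ∈ Ξ, w ξ * (F ξ - P ξ)| := abs_sub _ _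
    _ ≤ (1 + K) * B := by linarith

/-- (Interior error-kernel estimate) If `a : ℝ^d × Ξ → ℝ` is a stable, local polynomial
reproduction of order `2m`, radius `Γ h` and stability `K` on a set `A`, then the error
kernel satisfies `|φ(x-α) - ∑_ξ a(α,ξ) φ(x-ξ)| ≤ C h^{2m-d} (1 + ‖x-α‖/h)^{-(d+1)}`
with `C` depending only on `d`, `m`, `K` and `Γ`. -/
theorem interior_error_kernel_estimate (m d : ℕ) (hd : 1 ≤ d) (hm : d < 2 * m)
    (K Γ : ℝ) (hK : 1 ≤ K) (hΓ : 0 < Γ) :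
    ∃ C > 0, ∀ h : ℝ, 0 < h →
      ∀ (Ξ : Finset (EuclideanSpace ℝ (Fin d)))
        (A : Set (EuclideanSpace ℝ (Fin d)))
        (a : EuclideanSpace ℝ (Fin d) → EuclideanSpace ℝ (Fin d) → ℝ),
      (∀ α ∈ A, ∑ ξ ∈ Ξ, |a α ξ| ≤ K) →
      (∀ α ∈ A, ∀ p : MvPolynomial (Fin d) ℝ, p.totalDegree ≤ 2 * m →
        ∑ ξ ∈ Ξ, a α ξ * MvPolynomial.eval (fun i => ξ i) p
          = MvPolynomial.eval (fun i => α i) p) →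
      (∀ α ∈ A, ∀ ξ ∈ Ξ, Γ * h < ‖α - ξ‖ → a α ξ = 0) →
      ∀ x : EuclideanSpace ℝ (Fin d), ∀ α ∈ A,
        |surfSpline m d (x - α) - ∑ ξ ∈ Ξ, a α ξ * surfSpline m d (x - ξ)|
          ≤ C * h ^ (2 * (m : ℝ) - d) * (1 + ‖x - α‖ / h) ^ (-(d + 1 : ℝ)) := by
  have hK₀ : 0 ≤ K := by linarith
  obtain ⟨ε, hε, D, hD, happrox⟩ := unifPolyApprox_surfSpline hm (2 * m)
  obtain ⟨R, hR₁, hRε⟩ : ∃ R : ℝ, 1 ≤ R ∧ Γ ≤ ε * R :=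
    ⟨max 1 (Γ / ε), le_max_left _ _, (div_le_iff₀' hε).1 (le_max_right _ _)⟩
  obtain ⟨B, hB, hnear⟩ := exists_surfSpline_bound (d := d) hm (R + Γ)
  refine ⟨(1 + K) * B * (1 + R) ^ (d + 1) + (1 + K) * (D * Γ ^ (2 * m + 1)) * 2 ^ (d + 1) + 1,
    by positivity, fun h hh Ξ A a hstab hrep hloc x α hα => ?_⟩
  have hΓh : 0 ≤ Γ * h := by positivity
  have hexp : h ^ (2 * (m : ℝ) - d) = h ^ (2 * m - d) := by
    rw [← Real.rpow_natCast, Nat.cast_sub hm.le]; push_cast; rfl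
  have hdecay : (1 + ‖x - α‖ / h) ^ (-(d + 1 : ℝ)) = ((1 + ‖x - α‖ / h) ^ (d + 1))⁻¹ := by
    rw [Real.rpow_neg (by positivity), ← Real.rpow_natCast]; push_cast; rfl
  rw [hexp, hdecay, ← div_eq_mul_inv, le_div_iff₀ (by positivity)]
  rcases le_or_gt (‖x - α‖ / h) R with hq | hq
  · obtain ⟨Q, hQ, hscale⟩ := exists_surfSpline_scaling hm hh x
    have hest := abs_sub_sum_le_of_isPolyFun hΓh (B := h ^ (2 * m - d) * B) (by positivity)
      (hstab α hα) (hrep α hα) (hloc α hα) (F := fun ξ => surfSpline m d (x - ξ)) hQ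
      fun ξ hξ => by
        rw [hscale, add_sub_cancel_right, abs_mul, abs_of_pos (by positivity)]
        refine mul_le_mul_of_nonneg_left (hnear _ ?_) (by positivity)
        rw [norm_smul, norm_inv, Real.norm_of_nonneg hh.le, inv_mul_le_iff₀ hh]
        rw [div_le_iff₀ hh] at hq
        calc ‖x - ξ‖ = ‖(x - α) - (ξ - α)‖ := by rw [sub_sub_sub_cancel_right]
          _ ≤ ‖x - α‖ + ‖ξ - α‖ := norm_sub_le _ _
          _ ≤ h * (R + Γ) := by linarith
    calc _ ≤ (1 + K) * (h ^ (2 * m - d) * B) * (1 + R) ^ (d + 1) := by gcongr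
      _ = (1 + K) * B * (1 + R) ^ (d + 1) * h ^ (2 * m - d) := by ring
      _ ≤ _ := by
        rw [add_assoc]
        gcongr
        exact le_add_of_nonneg_right (by positivity)
  · have hr : 0 < ‖x - α‖ := (div_pos_iff_of_pos_right hh).1 (by linarith)
    obtain ⟨q, hqdef⟩ : ∃ q, q = ‖x - α‖ / h := ⟨_, rfl⟩
    rw [← hqdef] at hq ⊢
    have hq₀ : 0 < q := by linarith
    have hrq : ‖x - α‖ = h * q := by rw [hqdef]; field_simp
    obtain ⟨Q, hQ, hscale⟩ := exists_surfSpline_scaling hm hr x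
    have hv : ‖‖x - α‖⁻¹ • (x - α)‖ = 1 := by
      rw [norm_smul, norm_inv, norm_norm, inv_mul_cancel₀ hr.ne']
    obtain ⟨P, hP, happ⟩ := happrox _ hv
    beta_reduce at happ
    have hest := abs_sub_sum_le_of_isPolyFun hΓh
      (B := ‖x - α‖ ^ (2 * m - d) * (D * (Γ / q) ^ (2 * m + 1))) (by positivity)
      (hstab α hα) (hrep α hα) (hloc α hα) (F := fun ξ => surfSpline m d (x - ξ))
      (((hP.comp_affine ‖x - α‖⁻¹ α).const_mul (‖x - α‖ ^ (2 * m - d))).add hQ)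
      fun ξ hξ => by
        rw [hscale, add_sub_add_right_eq_sub, ← mul_sub, abs_mul, abs_of_pos (by positivity)]
        refine mul_le_mul_of_nonneg_left ?_ (by positivity)
        have hy : ‖‖x - α‖⁻¹ • (ξ - α)‖ ≤ Γ / q := by
          rw [norm_smul, norm_inv, norm_norm, inv_mul_le_iff₀ hr, hrq]
          refine hξ.trans (le_of_eq ?_)
          field_simp
        have hyε : Γ / q ≤ ε := by
          rw [div_le_iff₀ hq₀]
          exact hRε.trans (by gcongr)
        have := happ _ (hy.trans hyε)
        rw [← smul_sub, sub_sub_sub_cancel_right] at this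
        exact this.trans (by gcongr)
    have hpow : q ^ (2 * m - d) * q ^ (d + 1) = q ^ (2 * m + 1) := by
      rw [← pow_add]; congr 1; omega
    calc _ ≤ (1 + K) * (‖x - α‖ ^ (2 * m - d) * (D * (Γ / q) ^ (2 * m + 1)))
            * (2 * q) ^ (d + 1) := by gcongr; linarith
      _ = (1 + K) * (D * Γ ^ (2 * m + 1)) * 2 ^ (d + 1) * h ^ (2 * m - d) := by
        rw [hrq, mul_pow, mul_pow, div_pow]
        field_simp
        rw [← hpow]
        ring
      _ ≤ _ := by
        gcongr
        rw [add_assoc, add_left_comm]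
        exact le_add_of_nonneg_right (by positivity)
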